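/- Let r ≥ 2 be an integer and let X ⊆ [0,1] be ×r-invariant with dim_H X > 0. For all 0 < γ₄ < dim_H X < γ₅, there exists c > 0 such that for all sufficiently large N ∈ ℕ, the set X_N is an (r^{−N}, γ₅)_c-set satisfying r^{Nγ₄} ≤ |X_N| ≤ r^{Nγ₅}. -/

import Mathlib

/-- `X ⊆ [0,1]` is `×r`-invariant: closed and `T_r X ⊆ X` where `T_r x = r x (mod 1)`. -/
def TimesInvariant (r : ℕ) (X : Set ℝ) : Prop :=
  X ⊆ Set.Icc 0 1 ∧ IsClosed X ∧ ∀ x ∈ X, Int.fract ((r : ℝ) * x) ∈ X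

/-- The `n`-th discrete approximation of `X`: the set `X` rounded down to the lattice
`r^{-n} ℤ`, i.e. `i/r^n ∈ X_n` iff `X ∩ [i/r^n, (i+1)/r^n) ≠ ∅` (for `0 ≤ i < r^n`). -/
def approx (r : ℕ) (X : Set ℝ) (n : ℕ) : Set ℝ :=
  {t | ∃ i : ℕ, i < r ^ n ∧ t = (i : ℝ) / (r : ℝ) ^ n ∧
    (X ∩ Set.Ico ((i : ℝ) / (r : ℝ) ^ n) (((i : ℝ) + 1) / (r : ℝ) ^ n)).Nonempty}

/-- `A` is a `(ρ,γ)_c`-set: `ρ`-separated, and any open ball of diameter `δ ≥ ρ`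
contains at most `c (δ/ρ)^γ` of its points. -/
def IsRGCSet {α : Type*} [PseudoMetricSpace α] (ρ γ c : ℝ) (A : Set α) : Prop :=
  (∀ x ∈ A, ∀ y ∈ A, x ≠ y → ρ ≤ dist x y) ∧
  ∀ δ : ℝ, ρ ≤ δ → ∀ x : α,
    ((A ∩ Metric.ball x (δ / 2)).ncard : ℝ) ≤ c * (δ / ρ) ^ γ

open Classical in
noncomputable def apW (r : ℕ) (X : Set ℝ) (n : ℕ) : Finset ℕ :=
  (Finset.range (r ^ n)).filter (fun i => ∃ x ∈ X, x < 1 ∧ ⌊x * (r : ℝ) ^ n⌋₊ = i)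

lemma mem_apW {r : ℕ} (hr : 2 ≤ r) {X : Set ℝ} (n i : ℕ) :
    i ∈ apW r X n ↔ ∃ x ∈ X, x < 1 ∧ ⌊x * (r : ℝ) ^ n⌋₊ = i := by
  unfold apW
  simp only [Finset.mem_filter, Finset.mem_range, and_iff_right_iff_imp]
  rintro ⟨x, hx, hx1, rfl⟩
  have hp : (0 : ℝ) < (r : ℝ) ^ n := by positivity
  rw [Nat.floor_lt' (by positivity)]
  push_cast
  nlinarith

lemma approx_eq {r : ℕ} (hr : 2 ≤ r) {X : Set ℝ} (hX : X ⊆ Set.Icc 0 1) (n : ℕ) :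
    approx r X n = (fun i : ℕ => (i : ℝ) / (r : ℝ) ^ n) '' (apW r X n : Set ℕ) := by
  have hp : (0 : ℝ) < (r : ℝ) ^ n := by positivity
  ext t
  simp only [approx, Set.mem_ofPred_eq, Set.mem_image, Finset.mem_coe, mem_apW hr]
  constructor
  · rintro ⟨i, hi, rfl, x, hx, h1, h2⟩
    refine ⟨i, ⟨x, hx, ?_, ?_⟩, rfl⟩
    · refine h2.trans_le ?_
      rw [div_le_one hp]
      exact_mod_cast hi
    · rw [Nat.floor_eq_iff (mul_nonneg (hX hx).1 hp.le)]
      rw [div_le_iff₀ hp] at h1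
      rw [lt_div_iff₀ hp] at h2
      exact ⟨h1, h2⟩
  · rintro ⟨i, ⟨x, hx, hx1, hi⟩, rfl⟩
    rw [Nat.floor_eq_iff (mul_nonneg (hX hx).1 hp.le)] at hi
    refine ⟨i, ?_, rfl, x, hx, ?_, ?_⟩
    · have : (i : ℝ) < (r : ℝ) ^ n := by nlinarith
      exact_mod_cast this
    · rw [div_le_iff₀ hp]; exact hi.1
    · rw [lt_div_iff₀ hp]; exact hi.2

lemma approx_ncard {r : ℕ} (hr : 2 ≤ r) {X : Set ℝ} (hX : X ⊆ Set.Icc 0 1) (n : ℕ) :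
    (approx r X n).ncard = (apW r X n).card := by
  have hp : (0 : ℝ) < (r : ℝ) ^ n := by positivity
  rw [approx_eq hr hX, Set.ncard_image_of_injective, Set.ncard_coe_finset]
  intro a b h
  simp only [div_left_inj' hp.ne'] at h
  exact_mod_cast h

lemma floor_near (x y : ℝ) (h : |x - y| ≤ 1) :
    ⌊x⌋₊ ∈ Finset.Icc (⌊y⌋₊ - 1) (⌊y⌋₊ + 1) := by
  have key : ∀ x y : ℝ, x ≤ y + 1 → ⌊x⌋₊ ≤ ⌊y⌋₊ + 1 := by
    intro x y h
    rcases le_or_gt 0 y with hy | hy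
    · rw [← Nat.floor_add_one hy]; exact Nat.floor_mono h
    · have : ⌊x⌋₊ < 1 := by rw [Nat.floor_lt' one_ne_zero]; push_cast; linarith
      omega
  rw [abs_le] at h
  have h1 := key x y (by linarith)
  have h2 := key y x (by linarith)
  rw [Finset.mem_Icc]; omega

lemma iter_mem {r : ℕ} {X : Set ℝ} (hX : TimesInvariant r X) (k : ℕ) {x : ℝ} (hx : x ∈ X)
    (hx1 : x < 1) : Int.fract (x * (r : ℝ) ^ k) ∈ X := by
  induction k with
  | zero =>
    simp only [pow_zero, mul_one]
    rwa [Int.fract_eq_self.2 ⟨(hX.1 hx).1, hx1⟩]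
  | succ k ih =>
    have := hX.2.2 _ ih
    convert this using 1
    rw [Int.fract_eq_fract]
    refine ⟨r * ⌊x * (r : ℝ) ^ k⌋, ?_⟩
    push_cast
    rw [Int.fract]
    ring

lemma shift_mem {r : ℕ} (hr : 2 ≤ r) {X : Set ℝ} (hX : TimesInvariant r X) (k m : ℕ) {i : ℕ}
    (hi : i ∈ apW r X (k + m)) : i % r ^ m ∈ apW r X m := by
  rw [mem_apW hr] at hi ⊢
  obtain ⟨x, hx, hx1, hi⟩ := hi
  refine ⟨_, iter_mem hX k hx hx1, Int.fract_lt_one _, ?_⟩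
  have hp : (0 : ℝ) < (r : ℝ) ^ m := by positivity
  have hx0 : 0 ≤ x * (r : ℝ) ^ k := mul_nonneg (hX.1 hx).1 (by positivity)
  have hj : i / r ^ m = ⌊x * (r : ℝ) ^ k⌋₊ := by
    rw [← hi, ← Nat.floor_div_natCast]
    congr 1
    push_cast
    rw [pow_add]; field_simp
  have h1 : Int.fract (x * (r : ℝ) ^ k) * (r : ℝ) ^ m
      = x * (r : ℝ) ^ (k + m) - ((i / r ^ m * r ^ m : ℕ) : ℝ) := by
    rw [hj, Int.fract, ← natCast_floor_eq_intCast_floor hx0]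
    push_cast; ring
  rw [h1, Nat.floor_sub_natCast, hi]
  have := Nat.div_add_mod i (r ^ m)
  rw [mul_comm] at this
  generalize i % r ^ m = q at *
  omega

lemma card_fiber {r : ℕ} (hr : 2 ≤ r) {X : Set ℝ} (hX : TimesInvariant r X) (k m j : ℕ) :
    ((apW r X (k + m)).filter (fun i => i / r ^ m = j)).card ≤ (apW r X m).card := by
  apply Finset.card_le_card_of_injOn (fun i => i % r ^ m)
  · intro i hi
    exact shift_mem hr hX k m (Finset.mem_filter.1 hi).1
  · intro a ha b hb h
    have ha := (Finset.mem_filter.1 ha).2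
    have hb := (Finset.mem_filter.1 hb).2
    simp only at h
    rw [← Nat.div_add_mod a (r ^ m), ← Nat.div_add_mod b (r ^ m), ha, hb, h]

lemma card_near {r : ℕ} (hr : 2 ≤ r) {X : Set ℝ} (hX : TimesInvariant r X) (k m p : ℕ) :
    ((apW r X (k + m)).filter (fun i => i / r ^ m ∈ Finset.Icc (p - 1) (p + 1))).card
      ≤ 3 * (apW r X m).card := by
  have : (apW r X (k + m)).filter (fun i => i / r ^ m ∈ Finset.Icc (p - 1) (p + 1)) ⊆
      (Finset.Icc (p - 1) (p + 1)).biUnion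
        (fun j => (apW r X (k + m)).filter (fun i => i / r ^ m = j)) := by
    intro i hi
    rw [Finset.mem_filter] at hi
    rw [Finset.mem_biUnion]
    exact ⟨_, hi.2, Finset.mem_filter.2 ⟨hi.1, rfl⟩⟩
  refine (Finset.card_le_card this).trans (Finset.card_biUnion_le.trans ?_)
  refine (Finset.sum_le_card_nsmul _ _ _ (fun j _ => card_fiber hr hX k m j)).trans ?_
  rw [smul_eq_mul]
  apply Nat.mul_le_mul_right
  rw [Nat.card_Icc]; omega

lemma exists_level {r : ℕ} (hr : 2 ≤ r) {d : ℝ} (hd : 0 < d) (hd1 : d ≤ 1) :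
    ∃ k : ℕ, d * (r : ℝ) ^ k ≤ 1 ∧ 1 < r * (d * (r : ℝ) ^ k) := by
  have hr0 : (1 : ℝ) < r := by exact_mod_cast hr
  obtain ⟨k, h1, h2⟩ := exists_nat_pow_near (x := d⁻¹) (y := (r : ℝ))
    ((one_le_inv₀ hd).2 hd1) hr0
  refine ⟨k, ?_, ?_⟩
  · calc d * (r : ℝ) ^ k ≤ d * d⁻¹ := by gcongr
      _ = 1 := mul_inv_cancel₀ hd.ne'
  · calc 1 = d * d⁻¹ := (mul_inv_cancel₀ hd.ne').symm
      _ < d * (r : ℝ) ^ (k + 1) := by gcongr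
      _ = _ := by ring

lemma recursion {r : ℕ} (hr : 2 ≤ r) {X : Set ℝ} (hX : TimesInvariant r X)
    (F : Finset ℕ) (c d : ℕ → ℝ) (k : ℕ → ℕ)
    (hk : ∀ n ∈ F, d n * (r : ℝ) ^ k n ≤ 1)
    (hcov : X ⊆ ⋃ n ∈ F, Metric.ball (c n) (d n)) (N : ℕ) (hN : ∀ n ∈ F, k n ≤ N) :
    (apW r X N).card ≤ ∑ n ∈ F, 3 * (apW r X (N - k n)).card := by
  have hsub : apW r X N ⊆ F.biUnion (fun n => (apW r X N).filter
      (fun i => i / r ^ (N - k n) ∈ Finset.Icc (⌊c n * (r : ℝ) ^ k n⌋₊ - 1)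
        (⌊c n * (r : ℝ) ^ k n⌋₊ + 1))) := by
    intro i hi
    obtain ⟨x, hx, hx1, hxi⟩ := (mem_apW hr _ _).1 hi
    obtain ⟨n, hn, hxn⟩ := Set.mem_iUnion₂.1 (hcov hx)
    rw [Finset.mem_biUnion]
    refine ⟨n, hn, Finset.mem_filter.2 ⟨hi, ?_⟩⟩
    have hj : i / r ^ (N - k n) = ⌊x * (r : ℝ) ^ k n⌋₊ := by
      rw [← hxi, ← Nat.floor_div_natCast]
      congr 1
      push_cast
      rw [div_eq_iff (by positivity), mul_assoc, ← pow_add, Nat.add_sub_cancel' (hN n hn)]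
    rw [hj]
    apply floor_near
    rw [← sub_mul, abs_mul, abs_of_nonneg (by positivity : (0 : ℝ) ≤ (r : ℝ) ^ k n)]
    refine le_trans ?_ (hk n hn)
    gcongr
    rw [Metric.mem_ball, Real.dist_eq] at hxn
    exact hxn.le
  refine (Finset.card_le_card hsub).trans (Finset.card_biUnion_le.trans ?_)
  apply Finset.sum_le_sum
  intro n hn
  have := card_near hr hX (k n) (N - k n) ⌊c n * (r : ℝ) ^ k n⌋₊
  rwa [Nat.add_sub_cancel' (hN n hn)] at this

open MeasureTheory Filter Topology in
lemma exists_cover {X : Set ℝ} (hXc : IsCompact X) {g ε : ℝ} (hg : 0 < g) (hε : 0 < ε)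
    (h0 : μH[g] X = 0) :
    ∃ (F : Finset ℕ) (c d : ℕ → ℝ), (∀ n, 0 < d n) ∧
      X ⊆ ⋃ n ∈ F, Metric.ball (c n) (d n) ∧ ∑ n ∈ F, d n ^ g < ε := by
  rw [Measure.hausdorffMeasure_apply] at h0
  have h1 := (ENNReal.iSup_eq_zero.1 (ENNReal.iSup_eq_zero.1 h0 1)) one_pos
  have hε2 : (0 : ENNReal) < ENNReal.ofReal (ε / 2) := by simpa using hε
  rw [← h1] at hε2
  simp only [iInf_lt_iff] at hε2
  obtain ⟨t, hcov, hd1, hsum⟩ := hε2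
  obtain ⟨e, he, hesum⟩ := ENNReal.exists_pos_sum_of_countable
    (ε := ENNReal.ofReal (ε / 2)) (by simpa using hε) ℕ
  set a : ℕ → ENNReal := fun n => ⨆ _ : (t n).Nonempty, Metric.ediam (t n) ^ g with ha
  have hat : ∀ n, a n ≠ ⊤ := fun n => ENNReal.ne_top_of_tsum_ne_top (hsum.trans_le le_top).ne n
  have hs0 : ∀ n, 0 < (a n).toReal + e n := fun n =>
    add_pos_of_nonneg_of_pos ENNReal.toReal_nonneg (he n)
  have hc : ∀ n, ∃ c : ℝ, t n ⊆ Metric.ball c (((a n).toReal + e n) ^ (1 / g)) := by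
    intro n
    rcases (t n).eq_empty_or_nonempty with h | ⟨c, hc⟩
    · exact ⟨0, by simp [h]⟩
    · refine ⟨c, fun y hy => ?_⟩
      rw [Metric.mem_ball]
      have h2 : edist y c ≤ Metric.ediam (t n) := Metric.edist_le_ediam_of_mem hy hc
      have h3 : edist y c ^ g ≤ a n := by
        rw [ha]; simp only [show (t n).Nonempty from ⟨c, hc⟩, iSup_pos]
        exact ENNReal.rpow_le_rpow h2 hg.le
      have h4 : dist y c ^ g ≤ (a n).toReal := by
        rw [edist_dist, ENNReal.ofReal_rpow_of_nonneg dist_nonneg hg.le] at h3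
        exact (ENNReal.ofReal_le_iff_le_toReal (hat n)).1 h3
      have h5 : dist y c ^ g < (a n).toReal + e n := by
        have : (0 : ℝ) < e n := he n
        linarith
      calc dist y c = (dist y c ^ g) ^ (1 / g) := by
            rw [← Real.rpow_mul dist_nonneg, mul_one_div_cancel hg.ne', Real.rpow_one]
        _ < _ := Real.rpow_lt_rpow (by positivity) h5 (by positivity)
  choose c hc using hc
  obtain ⟨F, hF⟩ := hXc.elim_finite_subcover
    (fun n => Metric.ball (c n) (((a n).toReal + e n) ^ (1 / g))) (fun _ => Metric.isOpen_ball)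
    (hcov.trans (Set.iUnion_mono hc))
  refine ⟨F, c, _, fun n => Real.rpow_pos_of_pos (hs0 n) _, hF, ?_⟩
  have h6 : ∀ n, ((((a n).toReal + e n) ^ (1 / g)) ^ g : ℝ) = (a n).toReal + e n := by
    intro n
    rw [← Real.rpow_mul (hs0 n).le, one_div_mul_cancel hg.ne', Real.rpow_one]
  simp only [h6, Finset.sum_add_distrib]
  have h7 : ∑ n ∈ F, (a n).toReal < ε / 2 := by
    rw [← ENNReal.toReal_sum (fun n _ => hat n)]
    exact ENNReal.toReal_lt_of_lt_ofReal ((ENNReal.sum_le_tsum F).trans_lt hsum)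
  have h8 : ∑ n ∈ F, (e n : ℝ) < ε / 2 := by
    have := ENNReal.toReal_lt_of_lt_ofReal ((ENNReal.sum_le_tsum F).trans_lt hesum)
    rw [ENNReal.toReal_sum (fun n _ => ENNReal.coe_ne_top)] at this
    simpa using this
  linarith

open MeasureTheory in
lemma upper_bound {r : ℕ} (hr : 2 ≤ r) {X : Set ℝ} (hX : TimesInvariant r X) {g : ℝ}
    (hg : 0 < g) (h0 : μH[g] X = 0) :
    ∃ C : ℝ, 0 < C ∧ ∀ N : ℕ, ((apW r X N).card : ℝ) ≤ C * ((r : ℝ) ^ g) ^ N := by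
  have hr1 : (1 : ℝ) < r := by exact_mod_cast hr
  have hr0 : (0 : ℝ) < r := by linarith
  have hR1 : (1 : ℝ) < (r : ℝ) ^ g := Real.one_lt_rpow hr1 hg
  set R := (r : ℝ) ^ g with hR
  have hR0 : 0 < R := by linarith
  have hXc : IsCompact X := isCompact_Icc.of_isClosed_subset hX.2.1 hX.1
  obtain ⟨F, c, d, hd, hcov, hsum⟩ := exists_cover hXc hg (ε := (3 * R)⁻¹) (by positivity) h0
  have hdF : ∀ n ∈ F, R * d n ^ g < 1 := by
    intro n hn
    have h1 : d n ^ g < (3 * R)⁻¹ := lt_of_le_of_lt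
      (Finset.single_le_sum (f := fun n => d n ^ g)
        (fun n _ => Real.rpow_nonneg (hd n).le _) hn) hsum
    calc R * d n ^ g < R * (3 * R)⁻¹ := by gcongr
      _ = 1 / 3 := by field_simp
      _ < 1 := by norm_num
  have hd1 : ∀ n ∈ F, d n ≤ 1 := by
    intro n hn
    by_contra! h
    have h2 := Real.one_lt_rpow h hg
    have := hdF n hn
    nlinarith
  have hk : ∀ n, ∃ k : ℕ, n ∈ F → d n * (r : ℝ) ^ k ≤ 1 ∧ 1 < r * (d n * (r : ℝ) ^ k) := by
    intro n
    by_cases hn : n ∈ F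
    · obtain ⟨k, hk⟩ := exists_level hr (hd n) (hd1 n hn)
      exact ⟨k, fun _ => hk⟩
    · exact ⟨0, fun h => absurd h hn⟩
  choose k hk using hk
  have hkg : ∀ n ∈ F, 1 < R * d n ^ g * R ^ k n := by
    intro n hn
    have h1 := Real.one_lt_rpow (hk n hn).2 hg
    have hdn := hd n
    rw [Real.mul_rpow hr0.le (by positivity), Real.mul_rpow hdn.le (by positivity),
      ← Real.rpow_natCast, ← Real.rpow_mul hr0.le, mul_comm (k n : ℝ) g, Real.rpow_mul hr0.le,
      Real.rpow_natCast] at h1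
    rw [mul_assoc]; exact h1
  have hk1 : ∀ n ∈ F, 1 ≤ k n := by
    intro n hn
    by_contra! h
    have h2 := hkg n hn
    have h3 := hdF n hn
    rw [show k n = 0 by omega, pow_zero] at h2
    linarith
  have hw : ∑ n ∈ F, 3 * (R ^ k n)⁻¹ ≤ 1 := by
    calc ∑ n ∈ F, 3 * (R ^ k n)⁻¹ ≤ ∑ n ∈ F, 3 * R * d n ^ g := by
          apply Finset.sum_le_sum
          intro n hn
          have : (R ^ k n)⁻¹ ≤ R * d n ^ g := by
            rw [inv_le_iff_one_le_mul₀ (by positivity)]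
            exact (hkg n hn).le
          linarith
      _ = 3 * R * ∑ n ∈ F, d n ^ g := by rw [Finset.mul_sum]
      _ ≤ 3 * R * (3 * R)⁻¹ := by gcongr
      _ = 1 := mul_inv_cancel₀ (by positivity)
  set L := F.sup k with hL
  obtain ⟨C, hC⟩ : ∃ C : ℝ, C = ∑ N ∈ Finset.range L, ((apW r X N).card : ℝ) + 1 := ⟨_, rfl⟩
  have hC0 : 0 < C := by
    rw [hC]
    exact add_pos_of_nonneg_of_pos (Finset.sum_nonneg fun n _ => Nat.cast_nonneg _) one_pos
  refine ⟨C, hC0, fun N => ?_⟩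
  induction N using Nat.strong_induction_on with
  | _ N ih =>
    rcases lt_or_ge N L with hN | hN
    · have h1 : ((apW r X N).card : ℝ) ≤ C := by
        have := Finset.single_le_sum (f := fun N => ((apW r X N).card : ℝ))
          (fun n _ => Nat.cast_nonneg _) (Finset.mem_range.2 hN)
        linarith
      have h2 : 1 ≤ R ^ N := one_le_pow₀ hR1.le
      nlinarith
    · have hkN : ∀ n ∈ F, k n ≤ N := fun n hn => (Finset.le_sup hn).trans hN
      have h1 := recursion hr hX F c d k (fun n hn => (hk n hn).1) hcov N hkN
      calc ((apW r X N).card : ℝ) ≤ ∑ n ∈ F, 3 * ((apW r X (N - k n)).card : ℝ) := by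
            exact_mod_cast h1
        _ ≤ ∑ n ∈ F, (C * R ^ N) * (3 * (R ^ k n)⁻¹) := by
            apply Finset.sum_le_sum
            intro n hn
            have h2 := ih (N - k n) (by have := hk1 n hn; have := hkN n hn; omega)
            rw [pow_sub₀ _ hR0.ne' (hkN n hn)] at h2
            linarith
        _ = (C * R ^ N) * ∑ n ∈ F, 3 * (R ^ k n)⁻¹ := by rw [Finset.mul_sum]
        _ ≤ (C * R ^ N) * 1 := by gcongr
        _ = _ := mul_one _

open MeasureTheory Filter Topology in
lemma lower_bound {r : ℕ} (hr : 2 ≤ r) {X : Set ℝ} (hX : X ⊆ Set.Icc 0 1) {g : ℝ}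
    (hg : 0 < g) (h0 : μH[g] X = ⊤) :
    ∃ N₁ : ℕ, ∀ N, N₁ ≤ N → ((r : ℝ) ^ g) ^ N ≤ ((apW r X N).card : ℝ) := by
  by_contra! hcon
  have hr1 : (1 : ℝ) < r := by exact_mod_cast hr
  have hr0 : (0 : ℝ) < r := by linarith
  have hfreq : ∃ᶠ N in atTop, ((apW r X N).card : ℝ) < ((r : ℝ) ^ g) ^ N := by
    rw [frequently_atTop]
    exact hcon
  obtain ⟨φ, hφ, hlt⟩ := extraction_of_frequently_atTop hfreq
  have hle : μH[g] (X \ {1}) ≤ 1 := by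
    let ρ : ℕ → ENNReal := fun n => ENNReal.ofReal (((r : ℝ)⁻¹) ^ φ n)
    have hρ : Tendsto ρ atTop (𝓝 0) := by
      rw [← ENNReal.ofReal_zero]
      refine ENNReal.tendsto_ofReal ?_
      exact (tendsto_pow_atTop_nhds_zero_of_lt_one (by positivity)
        (inv_lt_one_of_one_lt₀ hr1)).comp hφ.tendsto_atTop
    let t : ∀ n : ℕ, (apW r X (φ n)) → Set ℝ := fun n i =>
      Set.Icc ((i : ℕ) / (r : ℝ) ^ φ n) (((i : ℕ) + 1) / (r : ℝ) ^ φ n)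
    have hdiam : ∀ n i, Metric.ediam (t n i) = ρ n := by
      intro n i
      simp only [t, ρ, Real.ediam_Icc]
      congr 1
      rw [← sub_div, add_sub_cancel_left, inv_pow, one_div]
    refine (Measure.hausdorffMeasure_le_liminf_sum g _ ρ hρ t
      (Eventually.of_forall fun n i => (hdiam n i).le) (Eventually.of_forall fun n x hx => ?_)).trans ?_
    · have hp : (0 : ℝ) < (r : ℝ) ^ φ n := by positivity
      have hx1 : x < 1 := lt_of_le_of_ne (hX hx.1).2 hx.2
      have hx0 := (hX hx.1).1
      rw [Set.mem_iUnion]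
      refine ⟨⟨⌊x * (r : ℝ) ^ φ n⌋₊, (mem_apW hr _ _).2 ⟨x, hx.1, hx1, rfl⟩⟩, ?_, ?_⟩
      · simp only
        rw [div_le_iff₀ hp]; exact Nat.floor_le (by positivity)
      · simp only
        rw [le_div_iff₀ hp]; exact (Nat.lt_floor_add_one _).le
    · have : ∀ n, ∑ i, Metric.ediam (t n i) ^ g ≤ 1 := by
        intro n
        simp only [hdiam, Finset.sum_const, Finset.card_univ, Fintype.card_coe, nsmul_eq_mul]
        have hp : (0 : ℝ) < ((r : ℝ) ^ g) ^ φ n := by positivity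
        have : ρ n ^ g = ENNReal.ofReal ((((r : ℝ) ^ g) ^ φ n)⁻¹) := by
          simp only [ρ]
          rw [ENNReal.ofReal_rpow_of_nonneg (by positivity) hg.le]
          congr 1
          rw [← Real.rpow_natCast, ← Real.rpow_mul (by positivity), mul_comm,
            Real.rpow_mul (by positivity), Real.rpow_natCast, Real.inv_rpow hr0.le, inv_pow]
        rw [this, ← ENNReal.ofReal_natCast, ← ENNReal.ofReal_mul (by positivity),
          ← ENNReal.ofReal_one]
        apply ENNReal.ofReal_le_ofReal
        rw [← div_eq_mul_inv, div_le_one hp]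
        exact (hlt n).le
      calc _ ≤ liminf (fun _ : ℕ => (1 : ENNReal)) atTop :=
            liminf_le_liminf (Eventually.of_forall this)
        _ = 1 := liminf_const _
  have h1 : μH[g] ({1} : Set ℝ) = 0 := by
    have := Measure.nullSingletonClass_hausdorff ℝ hg
    exact measure_singleton _
  have h2 : μH[g] X ≤ 1 := by
    calc μH[g] X ≤ μH[g] ((X \ {1}) ∪ {1}) := measure_mono (by
          intro x hx; by_cases h : x = 1 <;> simp [h, hx])
      _ ≤ μH[g] (X \ {1}) + μH[g] {1} := measure_union_le _ _
      _ ≤ 1 := by rw [h1, add_zero]; exact hle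
  rw [h0] at h2
  simp at h2

lemma ball_bound {r : ℕ} (hr : 2 ≤ r) {X : Set ℝ} (hX : TimesInvariant r X) {g C : ℝ}
    (hg : 0 < g) (hC : 0 < C) (hub : ∀ N : ℕ, ((apW r X N).card : ℝ) ≤ C * ((r : ℝ) ^ g) ^ N)
    (N : ℕ) : IsRGCSet (((r : ℝ) ^ N)⁻¹) g (3 * C * (r : ℝ) ^ g) (approx r X N) := by
  have hr1 : (1 : ℝ) < r := by exact_mod_cast hr
  have hr0 : (0 : ℝ) < r := by linarith
  have hp : (0 : ℝ) < (r : ℝ) ^ N := by positivity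
  have hRg : 1 < (r : ℝ) ^ g := Real.one_lt_rpow hr1 hg
  have hpg : ((r : ℝ) ^ N) ^ g = ((r : ℝ) ^ g) ^ N := by
    rw [← Real.rpow_natCast, ← Real.rpow_mul hr0.le, mul_comm, Real.rpow_mul hr0.le,
      Real.rpow_natCast]
  rw [approx_eq hr hX.1]
  refine ⟨?_, ?_⟩
  · rintro _ ⟨i, hi, rfl⟩ _ ⟨j, hj, rfl⟩ hij
    have hne : i ≠ j := by rintro rfl; exact hij rfl
    simp only
    rw [Real.dist_eq, ← sub_div, abs_div, abs_of_pos hp, inv_eq_one_div]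
    gcongr
    have : (1 : ℤ) ≤ |(i : ℤ) - j| := Int.one_le_abs (by omega)
    exact_mod_cast this
  · intro δ hδ x
    have hδ0 : 0 < δ := lt_of_lt_of_le (by positivity) hδ
    rw [div_inv_eq_mul]
    have hfin : ((fun i : ℕ => (i : ℝ) / (r : ℝ) ^ N) '' (apW r X N : Set ℕ)).Finite :=
      (Finset.finite_toSet _).image _
    rcases le_or_gt δ 1 with h1 | h1
    · obtain ⟨k, hk1, hk2⟩ := exists_level hr hδ0 h1
      have hkN : k ≤ N := by
        have : (r : ℝ) ^ k ≤ (r : ℝ) ^ N := by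
          have h3 : ((r : ℝ) ^ N)⁻¹ * (r : ℝ) ^ k ≤ 1 :=
            le_trans (by gcongr) hk1
          rwa [inv_mul_le_iff₀ hp, mul_one] at h3
        exact (pow_le_pow_iff_right₀ hr1).1 this
      have hsub : ((fun i : ℕ => (i : ℝ) / (r : ℝ) ^ N) '' (apW r X N : Set ℕ)) ∩
          Metric.ball x (δ / 2) ⊆ (fun i : ℕ => (i : ℝ) / (r : ℝ) ^ N) ''
          (((apW r X N).filter (fun i => i / r ^ (N - k) ∈
            Finset.Icc (⌊x * (r : ℝ) ^ k⌋₊ - 1) (⌊x * (r : ℝ) ^ k⌋₊ + 1)) : Finset ℕ) : Set ℕ) := by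
        rintro _ ⟨⟨i, hi, rfl⟩, hb⟩
        refine ⟨i, ?_, rfl⟩
        rw [Finset.mem_coe, Finset.mem_filter]
        refine ⟨hi, ?_⟩
        have hj : i / r ^ (N - k) = ⌊((i : ℝ) / (r : ℝ) ^ N) * (r : ℝ) ^ k⌋₊ := by
          rw [← Nat.floor_div_eq_div (K := ℝ)]
          congr 1
          push_cast
          rw [div_eq_iff (by positivity), mul_assoc, ← pow_add, Nat.add_sub_cancel' hkN,
            div_mul_cancel₀ _ hp.ne']
        rw [hj]
        apply floor_near
        rw [← sub_mul, abs_mul, abs_of_nonneg (by positivity : (0 : ℝ) ≤ (r : ℝ) ^ k)]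
        refine le_trans ?_ hk1
        gcongr
        rw [Metric.mem_ball, Real.dist_eq] at hb
        linarith
      have hcard := card_near hr hX k (N - k) ⌊x * (r : ℝ) ^ k⌋₊
      rw [Nat.add_sub_cancel' hkN] at hcard
      have h4 := (Set.ncard_le_ncard hsub ((Finset.finite_toSet _).image _)).trans
        ((Set.ncard_image_le (Finset.finite_toSet _)).trans
          ((Set.ncard_coe_finset _).le.trans hcard))
      have h5 : (((r : ℝ) ^ (N - k)) : ℝ) ≤ r * (δ * (r : ℝ) ^ N) := by
        rw [pow_sub₀ _ hr0.ne' hkN, ← div_eq_mul_inv, div_le_iff₀ (by positivity)]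
        nlinarith
      have h6 : ((r : ℝ) ^ g) ^ (N - k) ≤ (r : ℝ) ^ g * (δ * (r : ℝ) ^ N) ^ g := by
        have := Real.rpow_le_rpow (by positivity) h5 hg.le
        rwa [Real.mul_rpow hr0.le (by positivity), ← Real.rpow_natCast, ← Real.rpow_mul hr0.le,
          mul_comm _ g, Real.rpow_mul hr0.le, Real.rpow_natCast] at this
      calc _ ≤ ((3 * (apW r X (N - k)).card : ℕ) : ℝ) := by exact_mod_cast h4
        _ = 3 * ((apW r X (N - k)).card : ℝ) := by push_cast; ring
        _ ≤ 3 * (C * ((r : ℝ) ^ g) ^ (N - k)) := by gcongr; exact hub _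
        _ ≤ 3 * (C * ((r : ℝ) ^ g * (δ * (r : ℝ) ^ N) ^ g)) := by gcongr
        _ = _ := by ring
    · have h4 := (Set.ncard_le_ncard (Set.inter_subset_left (t := Metric.ball x (δ / 2))) hfin).trans
        ((Set.ncard_image_le (Finset.finite_toSet _)).trans (Set.ncard_coe_finset _).le)
      calc _ ≤ ((apW r X N).card : ℝ) := by exact_mod_cast h4
        _ ≤ C * ((r : ℝ) ^ g) ^ N := hub _
        _ = C * (1 * (r : ℝ) ^ N) ^ g := by rw [one_mul, hpg]
        _ ≤ C * (δ * (r : ℝ) ^ N) ^ g := by gcongr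
        _ = 1 * C * 1 * (δ * (r : ℝ) ^ N) ^ g := by ring
        _ ≤ 3 * C * (r : ℝ) ^ g * (δ * (r : ℝ) ^ N) ^ g := by gcongr; norm_num

open MeasureTheory Filter Topology in
theorem approx_is_discrete_fractal
    (r : ℕ) (hr : 2 ≤ r) (X : Set ℝ) (hX : TimesInvariant r X)
    (hdim : 0 < dimH X)
    (γ₄ γ₅ : ℝ) (h4 : 0 < γ₄) (h4d : γ₄ < (dimH X).toReal)
    (hd5 : (dimH X).toReal < γ₅) :
    ∃ c : ℝ, 0 < c ∧ ∃ N₁ : ℕ, ∀ N : ℕ, N₁ ≤ N →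
      IsRGCSet (((r : ℝ) ^ N)⁻¹) γ₅ c (approx r X N) ∧
      (r : ℝ) ^ ((N : ℝ) * γ₄) ≤ ((approx r X N).ncard : ℝ) ∧
      ((approx r X N).ncard : ℝ) ≤ (r : ℝ) ^ ((N : ℝ) * γ₅) := by
  have hr1 : (1 : ℝ) < r := by exact_mod_cast hr
  have hr0 : (0 : ℝ) < r := by linarith
  have hpow : ∀ (N : ℕ) (g : ℝ), (r : ℝ) ^ ((N : ℝ) * g) = ((r : ℝ) ^ g) ^ N := by
    intro N g
    rw [mul_comm, Real.rpow_mul hr0.le, Real.rpow_natCast]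
  have hfin : dimH X ≠ ⊤ := by
    have : dimH X ≤ 1 := by
      rw [← Real.dimH_univ]; exact dimH_mono (Set.subset_univ _)
    exact (this.trans_lt ENNReal.one_lt_top).ne
  have hmid : ∃ g, (dimH X).toReal < g ∧ g < γ₅ := exists_between hd5
  obtain ⟨g, hg1, hg2⟩ := hmid
  have hg0 : 0 < g := by linarith
  have hzero : μH[g] X = 0 := by
    have : dimH X < (g.toNNReal : ENNReal) := by
      rw [← ENNReal.ofReal_toReal hfin]
      exact (ENNReal.ofReal_lt_ofReal_iff hg0).2 hg1
    have := hausdorffMeasure_of_dimH_lt this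
    rwa [Real.coe_toNNReal _ hg0.le] at this
  have htop : μH[γ₄] X = ⊤ := by
    have : (γ₄.toNNReal : ENNReal) < dimH X := by
      rw [← ENNReal.ofReal_toReal hfin]
      exact (ENNReal.ofReal_lt_ofReal_iff (by linarith)).2 h4d
    have := hausdorffMeasure_of_lt_dimH this
    rwa [Real.coe_toNNReal _ h4.le] at this
  obtain ⟨C, hC, hub⟩ := upper_bound hr hX hg0 hzero
  obtain ⟨N₁, hN₁⟩ := lower_bound hr hX.1 h4 htop
  have hRlt : (r : ℝ) ^ g < (r : ℝ) ^ γ₅ := Real.rpow_lt_rpow_of_exponent_lt hr1 hg2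
  have hRg0 : 0 < (r : ℝ) ^ g := by positivity
  have hub5 : ∀ N : ℕ, ((apW r X N).card : ℝ) ≤ C * ((r : ℝ) ^ γ₅) ^ N := by
    intro N
    exact (hub N).trans (by gcongr)
  obtain ⟨N₂, hN₂⟩ := pow_unbounded_of_one_lt C ((one_lt_div hRg0).2 hRlt)
  refine ⟨3 * C * (r : ℝ) ^ γ₅, by positivity, max N₁ N₂, fun N hN => ⟨?_, ?_, ?_⟩⟩
  · exact ball_bound hr hX (by linarith) hC hub5 N
  · rw [hpow, approx_ncard hr hX.1]
    exact hN₁ N ((le_max_left _ _).trans hN)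
  · rw [hpow, approx_ncard hr hX.1]
    have h5 : C ≤ ((r : ℝ) ^ γ₅ / (r : ℝ) ^ g) ^ N :=
      hN₂.le.trans (pow_le_pow_right₀ ((one_lt_div hRg0).2 hRlt).le
        ((le_max_right _ _).trans hN))
    rw [div_pow, le_div_iff₀ (by positivity)] at h5
    exact (hub N).trans h5
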